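/- arXiv:math/0204112 — 3 statements merged into one kernel-verified Lean document; each statement's English description precedes it below -/
import Mathlib

section
/- Let A be an m-regular involutive quantale. Then A is both a generator and a cogenerator for the categories mreg-HMOD_A and mreg-Hilb_A. More exactly, for every M in these categories, M is both a quotient module of A^M (via the surjective compact map p_M = Ω_{(m)_{m∈M}}) and a submodule of A^M (via the injective compact map i_M = Ω_{(m)_{m∈M}}*). -/
universe u v w

set_option autoImplicit false

/-- An involutive quantale: a complete lattice with an associative multiplication
distributing over arbitrary joins in both arguments, together with an involution. -/
class InvQuantale (A : Type u) extends CompleteLattice A, Mul A, Star A where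
  qmul_assoc : ∀ a b c : A, a * b * c = a * (b * c)
  mul_sSup : ∀ (a : A) (S : Set A), a * sSup S = ⨆ b ∈ S, a * b
  sSup_mul : ∀ (S : Set A) (a : A), sSup S * a = ⨆ b ∈ S, b * a
  qstar_star : ∀ a : A, star (star a) = a
  star_sSup : ∀ S : Set A, star (sSup S) = ⨆ a ∈ S, star a
  qstar_mul : ∀ a b : A, star (a * b) = star b * star a

namespace Quantale

variable {A : Type u} [InvQuantale A]

theorem mul_iSup {ι : Sort w} (a : A) (f : ι → A) :
    (a * ⨆ i, f i) = ⨆ i, a * f i := by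
  rw [iSup, InvQuantale.mul_sSup, iSup_range]

theorem iSup_mul {ι : Sort w} (f : ι → A) (a : A) :
    (⨆ i, f i) * a = ⨆ i, f i * a := by
  rw [iSup, InvQuantale.sSup_mul, iSup_range]

theorem star_iSup {ι : Sort w} (f : ι → A) :
    star (⨆ i, f i) = ⨆ i, star (f i) := by
  rw [iSup, InvQuantale.star_sSup, iSup_range]

end Quantale

/-- A quantale is unital if it has a two-sided unit for the multiplication. -/
def InvQuantale.IsUnital (A : Type u) [InvQuantale A] : Prop :=
  ∃ e : A, ∀ a : A, e * a = a ∧ a * e = a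
section Modules

/-- A right module over an involutive quantale. -/
class QMod (A : Type u) [InvQuantale A] (M : Type v) [CompleteLattice M] where
  act : M → A → M
  act_mul : ∀ (m : M) (a b : A), act m (a * b) = act (act m a) b
  sSup_act : ∀ (S : Set M) (a : A), act (sSup S) a = ⨆ m ∈ S, act m a
  act_sSup : ∀ (m : M) (S : Set A), act m (sSup S) = ⨆ a ∈ S, act m a

/-- The module action `m ⋄ a`. -/
abbrev qact {A : Type u} [InvQuantale A] {M : Type v} [CompleteLattice M] [QMod A M]
    (m : M) (a : A) : M := QMod.act m a

/-- A right pre-Hilbert module over an involutive quantale. -/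
class QPreHilb (A : Type u) [InvQuantale A] (M : Type v) [CompleteLattice M] extends
    QMod A M where
  ip : M → M → A
  ip_mul : ∀ (m n : M) (a : A), ip m n * a = ip m (act n a)
  sSup_ip : ∀ (S : Set M) (n : M), ip (sSup S) n = ⨆ m ∈ S, ip m n
  ip_sSup : ∀ (m : M) (S : Set M), ip m (sSup S) = ⨆ n ∈ S, ip m n
  star_ip : ∀ m n : M, star (ip m n) = ip n m

/-- The inner product `⟨m, n⟩` with values in `A`. -/
abbrev qip (A : Type u) [InvQuantale A] {M : Type v} [CompleteLattice M] [QPreHilb A M]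
    (m n : M) : A := QPreHilb.ip m n

/-- A right Hilbert module: a pre-Hilbert module whose inner product separates points. -/
class QHilb (A : Type u) [InvQuantale A] (M : Type v) [CompleteLattice M] extends
    QPreHilb A M where
  ip_sep : ∀ m n : M, (∀ p : M, ip p m = ip p n) → m = n

variable {A : Type u} [InvQuantale A]

theorem qact_iSup_left {M : Type v} [CompleteLattice M] [QMod A M] {ι : Sort w}
    (f : ι → M) (a : A) : qact (⨆ i, f i) a = ⨆ i, qact (f i) a := by
  rw [iSup]; exact (QMod.sSup_act _ _).trans iSup_range

theorem qact_iSup_right {M : Type v} [CompleteLattice M] [QMod A M] {ι : Sort w}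
    (m : M) (f : ι → A) : qact m (⨆ i, f i) = ⨆ i, qact m (f i) := by
  rw [iSup]; exact (QMod.act_sSup _ _).trans iSup_range

theorem qip_iSup_left {M : Type v} [CompleteLattice M] [QPreHilb A M] {ι : Sort w}
    (f : ι → M) (n : M) : qip A (⨆ i, f i) n = ⨆ i, qip A (f i) n := by
  rw [iSup]; exact (QPreHilb.sSup_ip _ _).trans iSup_range

theorem qip_iSup_right {M : Type v} [CompleteLattice M] [QPreHilb A M] {ι : Sort w}
    (m : M) (f : ι → M) : qip A m (⨆ i, f i) = ⨆ i, qip A m (f i) := by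
  rw [iSup]; exact (QPreHilb.ip_sSup _ _).trans iSup_range

/-- A module is essential if every element is a join of elements of the form `m ⋄ a`. -/
def Essential (A : Type u) [InvQuantale A] (M : Type v) [CompleteLattice M] [QMod A M] :
    Prop :=
  ∀ m : M, m = sSup {x : M | (∃ (p : M) (a : A), x = qact p a) ∧ x ≤ m}

/-- A module is separated by `A` if the right actions separate points. -/
def Separated (A : Type u) [InvQuantale A] (M : Type v) [CompleteLattice M] [QMod A M] :
    Prop :=
  ∀ m n : M, (∀ a : A, qact m a = qact n a) → m = n

/-- A module is m-regular if it is essential and separated. -/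
def MRegMod (A : Type u) [InvQuantale A] (M : Type v) [CompleteLattice M] [QMod A M] :
    Prop :=
  Essential A M ∧ Separated A M

/-- A pre-Hilbert module is full if every element of `A` is a join of inner products. -/
def FullMod (A : Type u) [InvQuantale A] (M : Type v) [CompleteLattice M] [QPreHilb A M] :
    Prop :=
  ∀ a : A, a = sSup {b : A | (∃ m n : M, b = qip A m n) ∧ b ≤ a}

/-- An involutive quantale with multiplication as right action on itself. -/
instance selfQMod : QMod A A where
  act m a := m * a
  act_mul m a b := (InvQuantale.qmul_assoc m a b).symm
  sSup_act S a := InvQuantale.sSup_mul S a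
  act_sSup m S := InvQuantale.mul_sSup m S

/-- An involutive quantale as a pre-Hilbert module over itself, with `⟨a, b⟩ = a⋆ · b`. -/
instance selfQPreHilb : QPreHilb A A where
  ip a b := star a * b
  ip_mul m n a := InvQuantale.qmul_assoc _ _ _
  sSup_ip S n := by
    show star (sSup S) * n = ⨆ m ∈ S, star m * n
    rw [InvQuantale.star_sSup]
    simp only [Quantale.iSup_mul]
  ip_sSup m S := InvQuantale.mul_sSup _ S
  star_ip m n := by
    rw [InvQuantale.qstar_mul, InvQuantale.qstar_star]

/-- An involutive quantale is m-regular if it is m-regular as a right module over itself. -/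
def InvQuantale.MReg (A : Type u) [InvQuantale A] : Prop := MRegMod A A

/-- If right multiplications separate the points of `A`, then `A` is a right Hilbert module
over itself. -/
def selfQHilb (hsep : ∀ a b : A, (∀ c : A, a * c = b * c) → a = b) : QHilb A A where
  toQPreHilb := selfQPreHilb
  ip_sep := by
    intro m n h
    have h2 : ∀ c : A, star m * c = star n * c := by
      intro c
      have h1 : star c * m = star c * n := h c
      have h3 := congrArg star h1
      rw [InvQuantale.qstar_mul, InvQuantale.qstar_mul, InvQuantale.qstar_star] at h3
      exact h3
    have h4 := hsep _ _ h2
    have h5 := congrArg star h4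
    rwa [InvQuantale.qstar_star, InvQuantale.qstar_star] at h5

end Modules
section Pi

variable {A : Type u} [InvQuantale A]

/-- Pointwise right module structure on a power of a module. -/
instance piQMod (J : Type w) (M : Type v) [CompleteLattice M] [QMod A M] :
    QMod A (J → M) where
  act v a := fun j => qact (v j) a
  act_mul v a b := funext fun j => QMod.act_mul (v j) a b
  sSup_act S a := by
    funext j
    show qact (sSup S j) a = _
    rw [sSup_apply, qact_iSup_left, iSup_subtype]
    simp only [iSup_apply]
  act_sSup v S := by
    funext j
    show qact (v j) (sSup S) = _
    rw [show qact (v j) (sSup S) = ⨆ a ∈ S, qact (v j) a from QMod.act_sSup _ _]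
    simp only [iSup_apply]

/-- Pointwise pre-Hilbert structure on a power of a pre-Hilbert module, with inner product
`⟨v, w⟩ = ⨆ j, ⟨v j, w j⟩`.  In particular `A^J` carries the inner product
`⟨(a_j), (b_j)⟩ = ⨆ j, a_j⋆ · b_j`. -/
instance piQPreHilb (J : Type w) (M : Type v) [CompleteLattice M] [QPreHilb A M] :
    QPreHilb A (J → M) where
  ip v w := ⨆ j, qip A (v j) (w j)
  ip_mul v w a := by
    show (⨆ j, qip A (v j) (w j)) * a = ⨆ j, qip A (v j) (qact (w j) a)
    rw [Quantale.iSup_mul]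
    exact iSup_congr fun j => QPreHilb.ip_mul _ _ _
  sSup_ip S w := by
    show (⨆ j, qip A (sSup S j) (w j)) = ⨆ v ∈ S, ⨆ j, qip A (v j) (w j)
    calc (⨆ j, qip A (sSup S j) (w j))
        = ⨆ j, ⨆ f : S, qip A ((f : J → M) j) (w j) := by
          refine iSup_congr fun j => ?_
          rw [sSup_apply, qip_iSup_left]
      _ = ⨆ f : S, ⨆ j, qip A ((f : J → M) j) (w j) := iSup_comm
      _ = ⨆ v ∈ S, ⨆ j, qip A (v j) (w j) := by rw [iSup_subtype]
  ip_sSup v S := by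
    show (⨆ j, qip A (v j) (sSup S j)) = ⨆ w ∈ S, ⨆ j, qip A (v j) (w j)
    calc (⨆ j, qip A (v j) (sSup S j))
        = ⨆ j, ⨆ f : S, qip A (v j) ((f : J → M) j) := by
          refine iSup_congr fun j => ?_
          rw [sSup_apply, qip_iSup_right]
      _ = ⨆ f : S, ⨆ j, qip A (v j) ((f : J → M) j) := iSup_comm
      _ = ⨆ w ∈ S, ⨆ j, qip A (v j) (w j) := by rw [iSup_subtype]
  star_ip v w := by
    show star (⨆ j, qip A (v j) (w j)) = ⨆ j, qip A (w j) (v j)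
    rw [Quantale.star_iSup]
    exact iSup_congr fun j => QPreHilb.star_ip _ _

end Pi

section Maps

variable {A : Type u} [InvQuantale A]

/-- A module homomorphism: a join-preserving map commuting with the action. -/
def IsModHom (A : Type u) [InvQuantale A] {M : Type v} {N : Type w}
    [CompleteLattice M] [CompleteLattice N] [QMod A M] [QMod A N] (f : M → N) : Prop :=
  (∀ S : Set M, f (sSup S) = ⨆ m ∈ S, f m) ∧ ∀ (m : M) (a : A), f (qact m a) = qact (f m) a

/-- `g` is a ⋆-adjoint of `f`: `⟨f m, n⟩ = ⟨m, g n⟩`. -/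
def IsAdjointPair (A : Type u) [InvQuantale A] {M : Type v} {N : Type w}
    [CompleteLattice M] [CompleteLattice N] [QPreHilb A M] [QPreHilb A N]
    (f : M → N) (g : N → M) : Prop :=
  ∀ (m : M) (n : N), qip A (f m) n = qip A m (g n)

/-- A map between (pre-)Hilbert modules is adjointable if it has a ⋆-adjoint. -/
def Adjointable (A : Type u) [InvQuantale A] {M : Type v} {N : Type w}
    [CompleteLattice M] [CompleteLattice N] [QPreHilb A M] [QPreHilb A N]
    (f : M → N) : Prop :=
  ∃ g : N → M, IsAdjointPair A f g

theorem IsAdjointPair.symm' {M : Type v} {N : Type w}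
    [CompleteLattice M] [CompleteLattice N] [QPreHilb A M] [QPreHilb A N]
    {f : M → N} {g : N → M} (h : IsAdjointPair A f g) : IsAdjointPair A g f := by
  intro n m
  calc qip A (g n) m = star (qip A m (g n)) := (QPreHilb.star_ip m (g n)).symm
    _ = star (qip A (f m) n) := by rw [h m n]
    _ = qip A n (f m) := QPreHilb.star_ip _ _

/-- The rank-one operator `Θ_{n,m} : x ↦ n ⋄ ⟨m, x⟩`. -/
def theta (A : Type u) [InvQuantale A] {M : Type v} {N : Type w}
    [CompleteLattice M] [CompleteLattice N] [QPreHilb A M] [QPreHilb A N]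
    (n : N) (m : M) : M → N :=
  fun x => qact n (qip A m x)

/-- A compact operator: an arbitrary (pointwise) join of rank-one operators `Θ_{n,m}`. -/
def IsCompactOp (A : Type u) [InvQuantale A] {M : Type v} {N : Type w}
    [CompleteLattice M] [CompleteLattice N] [QPreHilb A M] [QPreHilb A N]
    (f : M → N) : Prop :=
  ∃ S : Set (N × M), ∀ x : M, f x = ⨆ p ∈ S, theta A p.1 p.2 x

end Maps

section LeftModules

/-- A left module over an involutive quantale. -/
class QLMod (A : Type u) [InvQuantale A] (M : Type v) [CompleteLattice M] where
  lact : A → M → M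
  lact_mul : ∀ (a b : A) (m : M), lact (a * b) m = lact a (lact b m)
  sSup_lact : ∀ (S : Set A) (m : M), lact (sSup S) m = ⨆ a ∈ S, lact a m
  lact_sSup : ∀ (a : A) (S : Set M), lact a (sSup S) = ⨆ m ∈ S, lact a m

/-- A left pre-Hilbert module over an involutive quantale. -/
class QLPreHilb (A : Type u) [InvQuantale A] (M : Type v) [CompleteLattice M] extends
    QLMod A M where
  lip : M → M → A
  lip_lact : ∀ (a : A) (m n : M), a * lip m n = lip (lact a m) n
  sSup_lip : ∀ (S : Set M) (n : M), lip (sSup S) n = ⨆ m ∈ S, lip m n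
  lip_sSup : ∀ (m : M) (S : Set M), lip m (sSup S) = ⨆ n ∈ S, lip m n
  star_lip : ∀ m n : M, star (lip m n) = lip n m

/-- A left Hilbert module. -/
class QLHilb (A : Type u) [InvQuantale A] (M : Type v) [CompleteLattice M] extends
    QLPreHilb A M where
  lip_sep : ∀ m n : M, (∀ p : M, lip m p = lip n p) → m = n

/-- A left module is essential if every element is a join of elements `a • m`. -/
def LEssential (A : Type u) [InvQuantale A] (M : Type v) [CompleteLattice M] [QLMod A M] :
    Prop :=
  ∀ m : M, m = sSup {x : M | (∃ (a : A) (p : M), x = QLMod.lact a p) ∧ x ≤ m}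

/-- A left module is separated by `A` if the left actions separate points. -/
def LSeparated (A : Type u) [InvQuantale A] (M : Type v) [CompleteLattice M] [QLMod A M] :
    Prop :=
  ∀ m n : M, (∀ a : A, QLMod.lact a m = QLMod.lact a n) → m = n

/-- A left pre-Hilbert module is full if every element of `A` is a join of inner products. -/
def LFull (A : Type u) [InvQuantale A] (M : Type v) [CompleteLattice M] [QLPreHilb A M] :
    Prop :=
  ∀ a : A, a = sSup {b : A | (∃ m n : M, b = QLPreHilb.lip m n) ∧ b ≤ a}

end LeftModules
open CategoryTheory

section Categories

variable {A : Type u} [InvQuantale A]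

/-- An object of the category `mreg-Hilb_A` (or `mreg-HMOD_A`): an m-regular right
Hilbert `A`-module. -/
structure HObj (A : Type u) [InvQuantale A] : Type (u + 1) where
  carrier : Type u
  [lat : CompleteLattice carrier]
  [str : QHilb A carrier]
  ess : Essential A carrier
  sep : Separated A carrier

attribute [instance] HObj.lat HObj.str

instance : CoeSort (HObj A) (Type u) := ⟨HObj.carrier⟩

/-- The category `mreg-Hilb_A` of m-regular right Hilbert `A`-modules with
adjointable maps as morphisms. -/
instance HObj.cat : Category.{u} (HObj A) where
  Hom M N := {f : M.carrier → N.carrier // Adjointable A f}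
  id M := ⟨fun m => m, ⟨fun m => m, fun _ _ => rfl⟩⟩
  comp {M N P} f g := ⟨fun m => g.1 (f.1 m), by
    obtain ⟨f', hf⟩ := f.2
    obtain ⟨g', hg⟩ := g.2
    exact ⟨fun p => f' (g' p), fun m p => (hg (f.1 m) p).trans (hf m (g' p))⟩⟩
  id_comp f := Subtype.ext rfl
  comp_id f := Subtype.ext rfl
  assoc f g h := Subtype.ext rfl

/-- Construct a morphism of `mreg-Hilb_A`. -/
def mkHom {M N : HObj A} (f : M.carrier → N.carrier) (hf : Adjointable A f) : M ⟶ N :=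
  ⟨f, hf⟩

/-- The underlying function of a morphism. -/
def homFn {M N : HObj A} (f : M ⟶ N) : M.carrier → N.carrier := f.1

/-- The ⋆-adjoint of a morphism of `mreg-Hilb_A`. -/
noncomputable def hStar {M N : HObj A} (f : M ⟶ N) : N ⟶ M :=
  ⟨Classical.choose f.2, ⟨f.1, (Classical.choose_spec f.2).symm'⟩⟩

theorem hStar_adj {M N : HObj A} (f : M ⟶ N) : IsAdjointPair A f.1 (hStar f).1 :=
  Classical.choose_spec f.2

/-- The join of a set of morphisms of `mreg-Hilb_A`, computed pointwise. -/
noncomputable def hSup {M N : HObj A} (S : Set (M ⟶ N)) : M ⟶ N :=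
  ⟨fun m => ⨆ f ∈ S, (f : M ⟶ N).1 m,
   ⟨fun n => ⨆ f ∈ S, (hStar f).1 n, by
      intro m n
      have L : qip A (⨆ f ∈ S, (f : M ⟶ N).1 m) n
          = ⨆ f ∈ S, qip A ((f : M ⟶ N).1 m) n := by
        rw [qip_iSup_left]
        exact iSup_congr fun f => qip_iSup_left _ _
      have R : qip A m (⨆ f ∈ S, (hStar f).1 n)
          = ⨆ f ∈ S, qip A m ((hStar f).1 n) := by
        rw [qip_iSup_right]
        exact iSup_congr fun f => qip_iSup_right _ _
      rw [L, R]
      exact iSup_congr fun f => iSup_congr fun _ => hStar_adj f m n⟩⟩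

/-- A morphism is unitary if its ⋆-adjoint is a two-sided inverse. -/
noncomputable def IsUnitaryHom {M N : HObj A} (f : M ⟶ N) : Prop :=
  f ≫ hStar f = 𝟙 M ∧ hStar f ≫ f = 𝟙 N

end Categories

section Functors

/-- A (join-preserving) ⋆-functor between the categories `mreg-Hilb_A` and `mreg-Hilb_B`. -/
structure StarFunctor (A B : Type u) [InvQuantale A] [InvQuantale B] : Type (u + 1) where
  toFunctor : HObj A ⥤ HObj B
  map_star : ∀ {M N : HObj A} (f : M ⟶ N),
    toFunctor.map (hStar f) = hStar (toFunctor.map f)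
  map_hSup : ∀ {M N : HObj A} (S : Set (M ⟶ N)),
    toFunctor.map (hSup S) = hSup (toFunctor.map '' S)

/-- Morita equivalence of involutive quantales: there are ⋆-functors `F, G` between
`mreg-Hilb_A` and `mreg-Hilb_B` with `GF ≅ Id` and `FG ≅ Id` via unitary natural
isomorphisms. -/
def Morita (A B : Type u) [InvQuantale A] [InvQuantale B] : Prop :=
  ∃ (F : StarFunctor A B) (G : StarFunctor B A)
    (η : F.toFunctor ⋙ G.toFunctor ⟶ 𝟭 (HObj A))
    (ζ : G.toFunctor ⋙ F.toFunctor ⟶ 𝟭 (HObj B)),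
    (∀ M : HObj A, IsUnitaryHom (η.app M)) ∧ (∀ N : HObj B, IsUnitaryHom (ζ.app N))

variable {A : Type u} [InvQuantale A]

/-- An m-regular involutive quantale as an object of `mreg-Hilb_A`. -/
def selfObj (A : Type u) [InvQuantale A] (hA : InvQuantale.MReg A) : HObj A where
  carrier := A
  lat := inferInstance
  str := selfQHilb hA.2
  ess := hA.1
  sep := hA.2

/-- Left multiplication by `a` as a morphism `A ⟶ A` of `mreg-Hilb_A`. -/
def lmulHom (A : Type u) [InvQuantale A] (hA : InvQuantale.MReg A) (a : A) :
    selfObj A hA ⟶ selfObj A hA :=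
  ⟨fun (b : A) => a * b, ⟨fun (b : A) => Star.star a * b, fun (m n : A) => by
    show Star.star (a * m) * n = Star.star m * (Star.star a * n)
    rw [InvQuantale.qstar_mul, InvQuantale.qmul_assoc]⟩⟩

/-- The left `A`-action `a • z = F(L_a)(z)` on `Z = F(A)` used in the Eilenberg-Watts
theorem. -/
def EWact {A B : Type u} [InvQuantale A] [InvQuantale B] (hA : InvQuantale.MReg A)
    (F : StarFunctor A B) :
    A → (F.toFunctor.obj (selfObj A hA)).carrier → (F.toFunctor.obj (selfObj A hA)).carrier :=
  fun a z => (F.toFunctor.map (lmulHom A hA a)).1 z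

end Functors
section Bimodules

/-- A right Hilbert `A`–`B` bimodule structure: `M` is a right Hilbert `B`-module with a
compatible left `A`-action. -/
structure IsRightHilbBimod (A B : Type u) [InvQuantale A] [InvQuantale B]
    (M : Type u) [CompleteLattice M] [QHilb B M] (lact : A → M → M) : Prop where
  lact_mul : ∀ (a b : A) (m : M), lact (a * b) m = lact a (lact b m)
  sSup_lact : ∀ (S : Set A) (m : M), lact (sSup S) m = ⨆ a ∈ S, lact a m
  lact_sSup : ∀ (a : A) (S : Set M), lact a (sSup S) = ⨆ m ∈ S, lact a m
  lact_act : ∀ (a : A) (x : M) (b : B), lact a (qact x b) = qact (lact a x) b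
  ip_lact : ∀ (a : A) (x y : M), qip B (lact a x) y = qip B x (lact (Star.star a) y)

/-- A left action is essential if every element is a join of elements `a • m`. -/
def LEssentialAct {A : Type u} {M : Type u} [CompleteLattice M] (lact : A → M → M) : Prop :=
  ∀ m : M, m = sSup {x : M | (∃ (a : A) (p : M), x = lact a p) ∧ x ≤ m}

/-- `t : M × N → P` realizes `P` as the interior tensor product `M ⊗̇_A N` of the right
Hilbert `A`-module `M` with the right Hilbert `A`–`B` bimodule `N` (with left action
`lactN`): `t` is bilinear for joins, its image join-generates `P`, and
`⟨x₁ ⊗ y₁, x₂ ⊗ y₂⟩ = ⟨y₁, ⟨x₁,x₂⟩ • y₂⟩`. -/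
structure IsInteriorTensor (A B : Type u) [InvQuantale A] [InvQuantale B]
    {M : Type u} [CompleteLattice M] [QHilb A M]
    {N : Type u} [CompleteLattice N] [QHilb B N] (lactN : A → N → N)
    {P : Type u} [CompleteLattice P] [QHilb B P]
    (t : M → N → P) : Prop where
  ip_t : ∀ (x₁ x₂ : M) (y₁ y₂ : N),
    qip B (t x₁ y₁) (t x₂ y₂) = qip B y₁ (lactN (qip A x₁ x₂) y₂)
  sSup_t : ∀ (S : Set M) (y : N), t (sSup S) y = ⨆ x ∈ S, t x y
  t_sSup : ∀ (x : M) (S : Set N), t x (sSup S) = ⨆ y ∈ S, t x y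
  gen : ∀ p : P, p = sSup {q : P | (∃ x y, q = t x y) ∧ q ≤ p}

/-- A bundled right Hilbert `A`-module. -/
structure HilbMod (A : Type u) [InvQuantale A] : Type (u + 1) where
  carrier : Type u
  [lat : CompleteLattice carrier]
  [str : QHilb A carrier]

attribute [instance] HilbMod.lat HilbMod.str

/-- A bundled right Hilbert `A`–`B` bimodule. -/
structure BimodObj (A B : Type u) [InvQuantale A] [InvQuantale B] : Type (u + 1) where
  carrier : Type u
  [lat : CompleteLattice carrier]
  [str : QHilb B carrier]
  lact : A → carrier → carrier
  bimod : IsRightHilbBimod A B carrier lact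

attribute [instance] BimodObj.lat BimodObj.str

/-- An imprimitivity `A`–`B` bimodule structure on `X`: a full m-regular right Hilbert
`B`-module and full m-regular left Hilbert `A`-module with compatible structures. -/
structure IsImprim (A B : Type u) [InvQuantale A] [InvQuantale B]
    (X : Type u) [CompleteLattice X] [QHilb B X]
    (lact : A → X → X) (lip : X → X → A) : Prop where
  bimod : IsRightHilbBimod A B X lact
  lip_lact : ∀ (a : A) (x y : X), a * lip x y = lip (lact a x) y
  sSup_lip : ∀ (S : Set X) (y : X), lip (sSup S) y = ⨆ x ∈ S, lip x y
  lip_sSup : ∀ (x : X) (S : Set X), lip x (sSup S) = ⨆ y ∈ S, lip x y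
  star_lip : ∀ x y : X, Star.star (lip x y) = lip y x
  lip_sep : ∀ x y : X, (∀ z : X, lip x z = lip y z) → x = y
  rfull : ∀ b : B, b = sSup {c : B | (∃ x y : X, c = qip B x y) ∧ c ≤ b}
  lfull : ∀ a : A, a = sSup {c : A | (∃ x y : X, c = lip x y) ∧ c ≤ a}
  ress : Essential B X
  rsep : Separated B X
  less : LEssentialAct lact
  lsep : ∀ m n : X, (∀ a : A, lact a m = lact a n) → m = n
  imp1 : ∀ x y z : X, lact (lip x y) z = qact x (qip B y z)
  imp2 : ∀ (x y : X) (b : B), lip (qact x b) y = lip x (qact y (Star.star b))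

/-- A bundled imprimitivity `A`–`B` bimodule; `A` and `B` are strongly Morita
equivalent iff such a bimodule exists. -/
structure ImprimObj (A B : Type u) [InvQuantale A] [InvQuantale B] : Type (u + 1) where
  carrier : Type u
  [lat : CompleteLattice carrier]
  [str : QHilb B carrier]
  lact : A → carrier → carrier
  lip : carrier → carrier → A
  imprim : IsImprim A B carrier lact lip

attribute [instance] ImprimObj.lat ImprimObj.str

end Bimodules

section Constructions

/-- The opposite involutive quantale `A^d`, with multiplication `a ∘ b = b · a`. -/
def InvQuantale.dual (A : Type u) [iq : InvQuantale A] : InvQuantale A :=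
  { iq.toCompleteLattice with
    mul := fun a b => b * a
    star := fun a => Star.star a
    qmul_assoc := fun a b c => (InvQuantale.qmul_assoc c b a).symm
    mul_sSup := fun a S => InvQuantale.sSup_mul S a
    sSup_mul := fun S a => InvQuantale.mul_sSup a S
    qstar_star := fun a => InvQuantale.qstar_star a
    star_sSup := fun S => InvQuantale.star_sSup S
    qstar_mul := fun a b => InvQuantale.qstar_mul b a }

/-- The involutive quantale of `J × J` matrices over `A`, with matrix multiplication
(joins in place of sums) and conjugate-transpose involution. -/
def MatrixQuantale (A : Type u) [InvQuantale A] (J : Type u) :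
    InvQuantale (J → J → A) :=
  { (inferInstance : CompleteLattice (J → J → A)) with
    mul := fun X Y i k => ⨆ j, X i j * Y j k
    star := fun X i j => Star.star (X j i)
    qmul_assoc := by
      intro X Y Z
      funext i l
      show (⨆ k, (⨆ j, X i j * Y j k) * Z k l) = ⨆ j, X i j * ⨆ k, Y j k * Z k l
      calc (⨆ k, (⨆ j, X i j * Y j k) * Z k l)
          = ⨆ k, ⨆ j, (X i j * Y j k) * Z k l := by
            exact iSup_congr fun k => Quantale.iSup_mul _ _
        _ = ⨆ j, ⨆ k, X i j * (Y j k * Z k l) := by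
            rw [iSup_comm]
            exact iSup_congr fun j => iSup_congr fun k => InvQuantale.qmul_assoc _ _ _
        _ = ⨆ j, X i j * ⨆ k, Y j k * Z k l := by
            exact iSup_congr fun j => (Quantale.mul_iSup _ _).symm
    mul_sSup := by
      intro X S
      funext i k
      show (⨆ j, X i j * sSup S j k) = _
      simp only [sSup_apply, iSup_apply, Quantale.mul_iSup]
      rw [iSup_comm]
      rw [iSup_subtype]
      rfl
    sSup_mul := by
      intro S X
      funext i k
      show (⨆ j, sSup S i j * X j k) = _
      simp only [sSup_apply, iSup_apply, Quantale.iSup_mul]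
      rw [iSup_comm]
      rw [iSup_subtype]
      rfl
    qstar_star := by
      intro X
      funext i j
      exact InvQuantale.qstar_star _
    star_sSup := by
      intro S
      funext i j
      show Star.star (sSup S j i) = _
      simp only [sSup_apply, iSup_apply, Quantale.star_iSup]
      rw [iSup_subtype]
    qstar_mul := by
      intro X Y
      funext i l
      show Star.star (⨆ j, X l j * Y j i) = ⨆ j, Star.star (Y j i) * Star.star (X l j)
      rw [Quantale.star_iSup]
      exact iSup_congr fun j => InvQuantale.qstar_mul _ _ }

/-- The property of belonging to the centre of `A`: a join-preserving bimodule
endomorphism that is adjointable for the right and left inner products. -/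
def IsCen (A : Type u) [InvQuantale A] (f : A → A) : Prop :=
  (∀ S : Set A, f (sSup S) = ⨆ a ∈ S, f a) ∧
  (∀ a b : A, f (a * b) = f a * b) ∧
  (∀ a b : A, f (a * b) = a * f b) ∧
  Adjointable A f ∧
  (∃ g : A → A, ∀ a b : A, f a * Star.star b = a * Star.star (g b))

/-- The centre of an m-regular involutive quantale. -/
def Cen (A : Type u) [InvQuantale A] : Type u := {f : A → A // IsCen A f}

end Constructions
/-- `A` is a generator for `mreg-HMOD_A`: every object admits an epimorphism (a
right-cancellable module map) from a direct sum of copies of `A`. -/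
def GeneratorHMOD (A : Type u) [InvQuantale A] : Prop :=
  ∀ X : HObj A, ∃ (Γ : Type u) (φ : (Γ → A) → X.carrier),
    IsModHom A φ ∧
    ∀ (P : HObj A) (g h : X.carrier → P.carrier),
      IsModHom A g → IsModHom A h → g ∘ φ = h ∘ φ → g = h

/-- `A` is a cogenerator for `mreg-HMOD_A`: every object admits a monomorphism into a
direct product of copies of `A`. -/
def CogeneratorHMOD (A : Type u) [InvQuantale A] : Prop :=
  ∀ X : HObj A, ∃ (Γ : Type u) (ψ : X.carrier → Γ → A),
    IsModHom A ψ ∧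
    ∀ (P : HObj A) (g h : P.carrier → X.carrier),
      IsModHom A g → IsModHom A h → ψ ∘ g = ψ ∘ h → g = h

/-- `A` is a generator for `mreg-Hilb_A`. -/
def GeneratorHilb (A : Type u) [InvQuantale A] : Prop :=
  ∀ X : HObj A, ∃ (Γ : Type u) (φ : (Γ → A) → X.carrier),
    Adjointable A φ ∧
    ∀ (P : HObj A) (g h : X.carrier → P.carrier),
      Adjointable A g → Adjointable A h → g ∘ φ = h ∘ φ → g = h

/-- `A` is a cogenerator for `mreg-Hilb_A`. -/
def CogeneratorHilb (A : Type u) [InvQuantale A] : Prop :=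
  ∀ X : HObj A, ∃ (Γ : Type u) (ψ : X.carrier → Γ → A),
    Adjointable A ψ ∧
    ∀ (P : HObj A) (g h : P.carrier → X.carrier),
      Adjointable A g → Adjointable A h → ψ ∘ g = ψ ∘ h → g = h

section GenHelpers

variable {A : Type u} [InvQuantale A]

/-- The map `p_M`. -/
def pMap (M : HObj A) : (M.carrier → A) → M.carrier :=
  fun v => ⨆ m : M.carrier, qact m (v m)

/-- The map `i_M`. -/
def iMap (M : HObj A) : M.carrier → M.carrier → A :=
  fun x m => qip A m x

theorem qip_act_left (M : HObj A) (n x : M.carrier) (a : A) :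
    qip A (qact n a) x = star a * qip A n x := by
  have h1 : star (qip A x (qact n a)) = qip A (qact n a) x := QPreHilb.star_ip _ _
  have h2 : qip A x n * a = qip A x (qact n a) := QPreHilb.ip_mul _ _ _
  have h3 : star (qip A x n) = qip A n x := QPreHilb.star_ip _ _
  rw [← h1, ← h2, InvQuantale.qstar_mul, h3]

theorem pi_adjoint (M : HObj A) : IsAdjointPair A (pMap M) (iMap M) := by
  intro v x
  show qip A (⨆ m : M.carrier, qact m (v m)) x = ⨆ m : M.carrier, star (v m) * qip A m x
  rw [qip_iSup_left]
  exact iSup_congr fun m => qip_act_left M m x (v m)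

theorem pMap_hom (M : HObj A) : IsModHom A (pMap M) := by
  constructor
  · intro S
    show (⨆ m : M.carrier, qact m (sSup S m)) = ⨆ v ∈ S, ⨆ m : M.carrier, qact m (v m)
    simp only [sSup_apply, qact_iSup_right]
    rw [iSup_comm, iSup_subtype]
  · intro v a
    show (⨆ m : M.carrier, qact m (v m * a)) = qact (⨆ m : M.carrier, qact m (v m)) a
    rw [qact_iSup_left]
    exact iSup_congr fun m => QMod.act_mul _ _ _

theorem iMap_hom (M : HObj A) : IsModHom A (iMap M) := by
  constructor
  · intro S
    funext m
    simp only [iSup_apply]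
    exact QPreHilb.ip_sSup _ _
  · intro x a
    funext m
    exact (QPreHilb.ip_mul _ _ _).symm

theorem iMap_inj (M : HObj A) : Function.Injective (iMap M) := by
  intro x y h
  exact QHilb.ip_sep (A := A) x y fun p => congrFun h p

theorem pMap_surj (M : HObj A) : Function.Surjective (pMap M) := by
  intro x
  refine ⟨fun n => sSup {a : A | qact n a ≤ x}, ?_⟩
  show (⨆ n : M.carrier, qact n (sSup {a : A | qact n a ≤ x})) = x
  apply le_antisymm
  · refine iSup_le fun n => ?_
    rw [show qact n (sSup {a : A | qact n a ≤ x}) = ⨆ a ∈ {a : A | qact n a ≤ x}, qact n a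
      from QMod.act_sSup _ _]
    exact iSup₂_le fun a ha => ha
  · conv_lhs => rw [M.ess x]
    refine sSup_le ?_
    rintro y ⟨⟨n, a, rfl⟩, hle⟩
    refine le_trans ?_ (le_iSup _ n)
    rw [show qact n (sSup {a : A | qact n a ≤ x}) = ⨆ a ∈ {a : A | qact n a ≤ x}, qact n a
      from QMod.act_sSup _ _]
    exact le_iSup₂_of_le a hle le_rfl

/-- The family equal to `a` at `m` and bottom elsewhere. -/
def bump {J : Type u} (m : J) (a : A) : J → A := fun j => ⨆ _ : j = m, a

theorem ip_bump {J : Type u} (m : J) (a : A) (v : J → A) :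
    qip A (bump m (star a)) v = a * v m := by
  show (⨆ j, star (⨆ _ : j = m, star a) * v j) = a * v m
  simp only [Quantale.star_iSup, Quantale.iSup_mul, InvQuantale.qstar_star, iSup_iSup_eq_left]

theorem ess_decomp (M : HObj A) (m : M.carrier) :
    m = ⨆ q ∈ {q : M.carrier × A | qact q.1 q.2 ≤ m}, qact q.1 q.2 := by
  apply le_antisymm
  · conv_lhs => rw [M.ess m]
    refine sSup_le ?_
    rintro y ⟨⟨n, a, rfl⟩, hle⟩
    exact le_iSup₂_of_le (f := fun (q : M.carrier × A)
      (_ : q ∈ {q : M.carrier × A | qact q.1 q.2 ≤ m}) => qact q.1 q.2) (n, a) hle le_rfl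
  · exact iSup₂_le fun q hq => hq

theorem pMap_compact (M : HObj A) : IsCompactOp A (pMap M) := by
  refine ⟨{p | ∃ (m n : M.carrier) (a : A), qact n a ≤ m ∧ p = (n, bump m (star a))}, ?_⟩
  intro v
  have key : ∀ (m n : M.carrier) (a : A),
      theta A n (bump m (star a)) v = qact (qact n a) (v m) := by
    intro m n a
    show qact n (qip A (bump m (star a)) v) = _
    rw [ip_bump]
    exact QMod.act_mul _ _ _
  apply le_antisymm
  · refine iSup_le fun m => ?_
    have hd : qact m (v m)
        = ⨆ q ∈ {q : M.carrier × A | qact q.1 q.2 ≤ m}, qact (qact q.1 q.2) (v m) := by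
      generalize v m = b
      conv_lhs => rw [ess_decomp M m]
      simp only [qact_iSup_left]
    rw [hd]
    refine iSup₂_le fun q hq => ?_
    rw [← key]
    exact le_iSup₂_of_le (f := fun (p : M.carrier × (M.carrier → A)) (_ : p ∈ {p |
      ∃ (m n : M.carrier) (a : A), qact n a ≤ m ∧ p = (n, bump m (star a))}) =>
      theta A p.1 p.2 v) (q.1, bump m (star q.2)) ⟨m, q.1, q.2, hq, rfl⟩ le_rfl
  · refine iSup₂_le ?_
    rintro p ⟨m, n, a, hle, rfl⟩
    show theta A n (bump m (star a)) v ≤ _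
    rw [key]
    refine le_trans ?_ (le_iSup (fun m : M.carrier => qact m (v m)) m)
    have h : qact (m ⊔ qact n a) (v m) = qact m (v m) ⊔ qact (qact n a) (v m) := by
      rw [← sSup_pair, show qact (sSup {m, qact n a}) (v m)
        = ⨆ x ∈ ({m, qact n a} : Set M.carrier), qact x (v m) from QMod.sSup_act _ _, iSup_pair]
    rw [sup_eq_left.2 hle] at h
    rw [h]
    exact le_sup_right

theorem iMap_compact (M : HObj A) : IsCompactOp A (iMap M) := by
  refine ⟨{p | ∃ (m n : M.carrier) (a : A), qact n a ≤ m ∧ p = (bump m (star a), n)}, ?_⟩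
  intro x
  have key : ∀ (m n : M.carrier) (a : A) (j : M.carrier),
      theta A (bump m (star a)) n x j = ⨆ _ : j = m, qip A (qact n a) x := by
    intro m n a j
    show (⨆ _ : j = m, star a) * qip A n x = _
    rw [Quantale.iSup_mul, qip_act_left]
  apply le_antisymm
  · intro m
    show qip A m x ≤ _
    conv_lhs => rw [ess_decomp M m]
    simp only [qip_iSup_left]
    refine iSup₂_le fun q hq => ?_
    have h1 : qip A (qact q.1 q.2) x ≤ theta A (bump m (star q.2)) q.1 x m := by
      rw [key]
      exact le_iSup (fun _ : m = m => qip A (qact q.1 q.2) x) rfl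
    refine h1.trans ?_
    exact (le_iSup₂_of_le (f := fun (p : (M.carrier → A) × M.carrier) (_ : p ∈ {p |
      ∃ (m n : M.carrier) (a : A), qact n a ≤ m ∧ p = (bump m (star a), n)}) =>
      theta A p.1 p.2 x) (bump m (star q.2), q.1) ⟨m, q.1, q.2, hq, rfl⟩ le_rfl) m
  · refine iSup₂_le ?_
    rintro p ⟨m, n, a, hle, rfl⟩ j
    show theta A (bump m (star a)) n x j ≤ _
    rw [key]
    refine iSup_le fun hj => ?_
    subst hj
    show _ ≤ qip A j x
    have h : qip A (j ⊔ qact n a) x = qip A j x ⊔ qip A (qact n a) x := by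
      rw [← sSup_pair, show qip A (sSup {j, qact n a}) x
        = ⨆ y ∈ ({j, qact n a} : Set M.carrier), qip A y x from QPreHilb.sSup_ip _ _, iSup_pair]
    rw [sup_eq_left.2 hle] at h
    rw [h]
    exact le_sup_right

end GenHelpers

/-- An m-regular involutive quantale `A` is both a generator and a
cogenerator for `mreg-HMOD_A` and `mreg-Hilb_A`; more exactly, every `M` is a quotient
of `A^M` via the surjective compact map `p_M = Ω_{(m)_{m∈M}}` and a submodule of `A^M`
via the injective compact map `i_M = Ω_{(m)_{m∈M}}⋆`. -/
theorem quantale_generator_cogenerator (A : Type u) [InvQuantale A]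
    (hA : InvQuantale.MReg A) :
    GeneratorHMOD A ∧ CogeneratorHMOD A ∧ GeneratorHilb A ∧ CogeneratorHilb A ∧
    ∀ M : HObj A,
      IsCompactOp A (fun v : M.carrier → A => ⨆ m : M.carrier, qact m (v m)) ∧
      Function.Surjective (fun v : M.carrier → A => ⨆ m : M.carrier, qact m (v m)) ∧
      IsCompactOp A (fun (x : M.carrier) (m : M.carrier) => qip A m x) ∧
      Function.Injective (fun (x : M.carrier) (m : M.carrier) => qip A m x) := by
  refine ⟨fun X => ⟨X.carrier, pMap X, pMap_hom X, ?_⟩,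
    fun X => ⟨X.carrier, iMap X, iMap_hom X, ?_⟩,
    fun X => ⟨X.carrier, pMap X, ⟨_, pi_adjoint X⟩, ?_⟩,
    fun X => ⟨X.carrier, iMap X, ⟨_, (pi_adjoint X).symm'⟩, ?_⟩,
    fun M => ⟨pMap_compact M, pMap_surj M, iMap_compact M, iMap_inj M⟩⟩
  · intro P g h _ _ e
    exact (pMap_surj X).injective_comp_right e
  · intro P g h _ _ e
    exact (iMap_inj X).comp_left e
  · intro P g h _ _ e
    exact (pMap_surj X).injective_comp_right e
  · intro P g h _ _ e
    exact (iMap_inj X).comp_left e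
end

section
/- Let A be an m-regular involutive quantale. Then every surjective module homomorphism p : P → M in mreg-HMOD_A is the coequalizer of a pair (u, v) of compact arrows u, v : A^J → P for a suitable index set J. -/
universe u v w

set_option autoImplicit false

open CategoryTheory

section Helpers

variable {A : Type u} [InvQuantale A]

theorem qact_bot_right {M : Type v} [CompleteLattice M] [QMod A M] (m : M) :
    qact m (⊥ : A) = ⊥ := by
  have h := QMod.act_sSup (A := A) m ∅
  simpa using h

theorem q_mul_bot (a : A) : a * ⊥ = ⊥ := by
  simpa using InvQuantale.mul_sSup a ∅

theorem q_bot_mul (a : A) : ⊥ * a = ⊥ := by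
  simpa using InvQuantale.sSup_mul ∅ a

theorem q_star_bot : star (⊥ : A) = ⊥ := by
  simpa using InvQuantale.star_sSup (∅ : Set A)

/-- The family supported at `j` with value `a`. -/
noncomputable def famAt {J : Type v} (j : J) (a : A) : J → A :=
  fun k => ⨆ _ : k = j, a

theorem qip_famAt {J : Type v} (j : J) (b : A) (x : J → A) :
    qip A (famAt j b) x = star b * x j := by
  show (⨆ k, star (⨆ _ : k = j, b) * x k) = star b * x j
  simp only [Quantale.star_iSup, Quantale.iSup_mul, iSup_iSup_eq_left]

/-- The map `A^J → P`, `a ↦ ⨆ j, x_j ⋄ (b_j · a_j)`. -/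
noncomputable def famMap {P : Type v} [CompleteLattice P] [QMod A P] {J : Type w}
    (x : J → P) (b : J → A) : (J → A) → P :=
  fun a => ⨆ j, qact (x j) (b j * a j)

theorem famMap_compact {P : Type v} [CompleteLattice P] [QPreHilb A P] {J : Type w}
    (x : J → P) (b : J → A) : IsCompactOp A (famMap x b) := by
  refine ⟨Set.range fun j => (x j, famAt j (star (b j))), fun a => ?_⟩
  rw [iSup_range]
  refine iSup_congr fun j => ?_
  show _ = qact (x j) (qip A (famAt j (star (b j))) a)
  rw [qip_famAt, InvQuantale.qstar_star]

theorem famMap_famAt {P : Type v} [CompleteLattice P] [QMod A P] {J : Type w}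
    (x : J → P) (b : J → A) (j : J) (a : A) :
    famMap x b (famAt j a) = qact (qact (x j) (b j)) a := by
  show (⨆ k, qact (x k) (b k * ⨆ _ : k = j, a)) = _
  simp only [Quantale.mul_iSup, qact_iSup_right, iSup_iSup_eq_left]
  exact QMod.act_mul _ _ _

theorem IsModHom.map_iSup' {M : Type v} {N : Type w}
    [CompleteLattice M] [CompleteLattice N] [QMod A M] [QMod A N] {f : M → N}
    (hf : IsModHom A f) {ι : Type*} (g : ι → M) : f (⨆ i, g i) = ⨆ i, f (g i) := by
  rw [iSup, hf.1, iSup_range]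

end Helpers

/-- Over an m-regular involutive quantale `A`, every surjective
module homomorphism `p : P → M` in `mreg-HMOD_A` is the coequalizer of a pair of
compact arrows `u, v : A^J → P` for a suitable index set `J`. -/
theorem surjection_is_coequalizer_of_compacts (A : Type u) [InvQuantale A]
    (hA : InvQuantale.MReg A) (P M : HObj A) (p : P.carrier → M.carrier)
    (hp : IsModHom A p) (hsurj : Function.Surjective p) :
    ∃ (J : Type u) (u v : (J → A) → P.carrier),
      IsCompactOp A u ∧ IsCompactOp A v ∧ p ∘ u = p ∘ v ∧
      ∀ (Z : HObj A) (f : P.carrier → Z.carrier),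
        IsModHom A f → f ∘ u = f ∘ v →
        ∃! g : M.carrier → Z.carrier, IsModHom A g ∧ g ∘ p = f := by
  classical
  let J : Type u := {t : P.carrier × P.carrier × A // p t.1 = p t.2.1}
  let x : J → P.carrier := fun j => j.1.1
  let y : J → P.carrier := fun j => j.1.2.1
  let b : J → A := fun j => j.1.2.2
  refine ⟨J, famMap x b, famMap y b, famMap_compact x b, famMap_compact y b, ?_, ?_⟩
  · funext a
    show p (⨆ j, qact (x j) (b j * a j)) = p (⨆ j, qact (y j) (b j * a j))
    rw [hp.map_iSup', hp.map_iSup']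
    refine iSup_congr fun j => ?_
    rw [hp.2, hp.2]
    exact congrArg (fun m => qact m (b j * a j)) j.2
  · intro Z f hf hfuv
    have key : ∀ s t, p s = p t → f s = f t := by
      intro s t hst
      refine Z.sep _ _ fun c => Z.sep _ _ fun a => ?_
      have h := congrFun hfuv (famAt (⟨(s, t, c), hst⟩ : J) a)
      simp only [Function.comp_apply, famMap_famAt] at h
      rw [hf.2, hf.2, hf.2, hf.2] at h
      exact h
    have hinv : ∀ m, p (Function.surjInv hsurj m) = m := Function.surjInv_eq hsurj
    have hgp : ∀ s, f (Function.surjInv hsurj (p s)) = f s := fun s => key _ _ (hinv _)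
    refine ⟨fun m => f (Function.surjInv hsurj m), ⟨⟨?_, ?_⟩, funext hgp⟩, ?_⟩
    · intro S
      have h1 : sSup S = p (⨆ m : S, Function.surjInv hsurj m.1) := by
        rw [hp.map_iSup']
        simp only [hinv]
        exact sSup_eq_iSup' S
      show f (Function.surjInv hsurj (sSup S)) = _
      rw [h1, hgp, hf.map_iSup', iSup_subtype]
    · intro m a
      show f (Function.surjInv hsurj (qact m a)) = qact (f (Function.surjInv hsurj m)) a
      rw [← hf.2]
      apply key
      rw [hinv, hp.2, hinv]
    · rintro g ⟨_, hg⟩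
      funext m
      show g m = f (Function.surjInv hsurj m)
      rw [← hg, Function.comp_apply, hinv]
end

section
/- Let A and B be m-regular involutive quantales and let X₁, X₂ be essential right Hilbert A–B bimodules such that F₁ = (−)⊗̇_A X₁ and F₂ = (−)⊗̇_A X₂ define functors from mreg-Hilb_A to mreg-Hilb_B. Then F₁ and F₂ are unitarily naturally isomorphic if and only if X₁ ≅ X₂ unitarily and as bimodules. -/
universe u v w

set_option autoImplicit false

open CategoryTheory

section Helpers

variable {B : Type u} [InvQuantale B]

theorem gen_iSup {P : Type u} [CompleteLattice P] {ι : Type u} (p : ι → P)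
    (hp : ∀ x, x = sSup {y | (∃ i, y = p i) ∧ y ≤ x}) (x : P) :
    x = ⨆ i : {i // p i ≤ x}, p i.1 := by
  apply le_antisymm
  · conv_lhs => rw [hp x]
    apply sSup_le
    rintro _ ⟨⟨i, rfl⟩, hi⟩
    exact le_iSup (fun i : {i // p i ≤ x} => p i.1) ⟨i, hi⟩
  · exact iSup_le fun i => i.2

theorem sep_gen {P : Type u} [CompleteLattice P] [QHilb B P] {ι : Type u} (p : ι → P)
    (hp : ∀ x, x = sSup {y | (∃ i, y = p i) ∧ y ≤ x}) (m n : P)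
    (h : ∀ i, qip B (p i) m = qip B (p i) n) : m = n := by
  apply QHilb.ip_sep (A := B)
  intro x
  change qip B x m = qip B x n
  rw [gen_iSup p hp x, qip_iSup_left, qip_iSup_left]
  exact iSup_congr fun i => h i.1

theorem half_unitary {P Q : Type u} [CompleteLattice P] [CompleteLattice Q]
    [QHilb B P] [QHilb B Q] {ι : Type u} (p : ι → P) (q : ι → Q)
    (hp : ∀ x, x = sSup {y | (∃ i, y = p i) ∧ y ≤ x})
    (h : ∀ i j, qip B (p i) (p j) = qip B (q i) (q j)) (x : P) (j : ι) :
    qip B (q j) (⨆ i : {i // p i ≤ x}, q i.1) = qip B (p j) x := by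
  conv_rhs => rw [gen_iSup p hp x]
  rw [qip_iSup_right, qip_iSup_right]
  exact iSup_congr fun i => (h j i.1).symm

theorem exists_unitary {P Q : Type u} [CompleteLattice P] [CompleteLattice Q]
    [QHilb B P] [QHilb B Q] {ι : Type u} (p : ι → P) (q : ι → Q)
    (hp : ∀ x, x = sSup {y | (∃ i, y = p i) ∧ y ≤ x})
    (hq : ∀ x, x = sSup {y | (∃ i, y = q i) ∧ y ≤ x})
    (h : ∀ i j, qip B (p i) (p j) = qip B (q i) (q j)) :
    ∃ U : P → Q, Function.Bijective U ∧ (∀ x y, qip B (U x) (U y) = qip B x y) ∧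
      ∀ i, U (p i) = q i := by
  have hU := half_unitary p q hp h
  have hV := half_unitary q p hq (fun i j => (h i j).symm)
  refine ⟨fun x => ⨆ i : {i // p i ≤ x}, q i.1, ?_, ?_, ?_⟩
  · rw [Function.bijective_iff_has_inverse]
    refine ⟨fun y => ⨆ i : {i // q i ≤ y}, p i.1, ?_, ?_⟩
    · intro x
      apply sep_gen (B := B) p hp
      intro j
      rw [hV, hU]
    · intro x
      apply sep_gen (B := B) q hq
      intro j
      rw [hU, hV]
  · intro x y
    beta_reduce
    rw [qip_iSup_left]
    conv_rhs => rw [gen_iSup p hp x]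
    rw [qip_iSup_left]
    exact iSup_congr fun i => hU y i.1
  · intro i
    apply sep_gen (B := B) q hq
    intro j
    rw [hU, h]

theorem adj_of_iso {P Q : Type u} [CompleteLattice P] [CompleteLattice Q]
    [QHilb B P] [QHilb B Q] {U : P → Q} (hb : Function.Bijective U)
    (hi : ∀ x y, qip B (U x) (U y) = qip B x y) : Adjointable B U := by
  obtain ⟨V, _, hV⟩ := Function.bijective_iff_has_inverse.1 hb
  exact ⟨V, fun m n => by rw [← hi m (V n), hV n]⟩

theorem adj_iSup {P Q : Type u} [CompleteLattice P] [CompleteLattice Q]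
    [QHilb B P] [QHilb B Q] {f : P → Q} (hf : Adjointable B f) {ι : Sort w} (s : ι → P) :
    f (⨆ i, s i) = ⨆ i, f (s i) := by
  obtain ⟨g, hg⟩ := hf
  apply QHilb.ip_sep (A := B)
  intro n
  change qip B n _ = qip B n _
  rw [← hg.symm', qip_iSup_right, qip_iSup_right]
  exact iSup_congr fun i => hg.symm' _ _

theorem adj_sSup {P Q : Type u} [CompleteLattice P] [CompleteLattice Q]
    [QHilb B P] [QHilb B Q] {f : P → Q} (hf : Adjointable B f) (S : Set P) :
    f (sSup S) = ⨆ x ∈ S, f x := by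
  rw [sSup_eq_iSup, adj_iSup hf]
  exact iSup_congr fun i => adj_iSup hf _

theorem adj_act {P Q : Type u} [CompleteLattice P] [CompleteLattice Q]
    [QHilb B P] [QHilb B Q] {f : P → Q} (hf : Adjointable B f) (x : P) (b : B) :
    f (qact x b) = qact (f x) b := by
  obtain ⟨g, hg⟩ := hf
  apply QHilb.ip_sep (A := B)
  intro n
  change qip B n _ = qip B n _
  rw [← hg.symm']
  have h1 : qip B (g n) (qact x b) = qip B (g n) x * b := (QPreHilb.ip_mul _ _ _).symm
  have h2 : qip B n (qact (f x) b) = qip B n (f x) * b := (QPreHilb.ip_mul _ _ _).symm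
  rw [h1, h2, hg.symm']

theorem adj_comp {P Q R : Type u} [CompleteLattice P] [CompleteLattice Q] [CompleteLattice R]
    [QHilb B P] [QHilb B Q] [QHilb B R] {f : P → Q} {g : Q → R} (hf : Adjointable B f)
    (hg : Adjointable B g) : Adjointable B (fun x => g (f x)) := by
  obtain ⟨f', hf⟩ := hf
  obtain ⟨g', hg⟩ := hg
  exact ⟨fun x => f' (g' x), fun m n => (hg _ _).trans (hf _ _)⟩

/-- Two adjointable maps agreeing on join-generators are equal. -/
theorem adj_ext {P Q : Type u} [CompleteLattice P] [CompleteLattice Q]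
    [QHilb B P] [QHilb B Q] {f g : P → Q} (hf : Adjointable B f) (hg : Adjointable B g)
    {ι : Type u} (p : ι → P) (hp : ∀ x, x = sSup {y | (∃ i, y = p i) ∧ y ≤ x})
    (h : ∀ i, f (p i) = g (p i)) (x : P) : f x = g x := by
  rw [gen_iSup p hp x, adj_iSup hf, adj_iSup hg]
  exact iSup_congr fun i => h i.1

theorem unitary_of_iso {M N : HObj B} (f : M ⟶ N) (hb : Function.Bijective f.1)
    (hi : ∀ x y, qip B (f.1 x) (f.1 y) = qip B x y) : IsUnitaryHom f := by
  have key : ∀ m, (hStar f).1 (f.1 m) = m := by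
    intro m
    apply QHilb.ip_sep (A := B)
    intro n
    change qip B n _ = qip B n _
    rw [← hStar_adj f, hi]
  refine ⟨Subtype.ext (funext key), Subtype.ext (funext fun n => ?_)⟩
  obtain ⟨m, rfl⟩ := hb.2 n
  exact congrArg f.1 (key m)

theorem iso_of_unitary {M N : HObj B} (f : M ⟶ N) (h : IsUnitaryHom f) :
    Function.Bijective f.1 ∧ ∀ x y, qip B (f.1 x) (f.1 y) = qip B x y := by
  have h1 : ∀ m, (hStar f).1 (f.1 m) = m := fun m => congrFun (congrArg Subtype.val h.1) m
  have h2 : ∀ n, f.1 ((hStar f).1 n) = n := fun n => congrFun (congrArg Subtype.val h.2) n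
  refine ⟨Function.bijective_iff_has_inverse.2 ⟨(hStar f).1, h1, h2⟩, fun x y => ?_⟩
  rw [hStar_adj f, h1]

theorem tensor_gen {A : Type u} [InvQuantale A] {M : Type u} [CompleteLattice M] [QHilb A M]
    {N : Type u} [CompleteLattice N] [QHilb B N] {lactN : A → N → N}
    {P : Type u} [CompleteLattice P] [QHilb B P] {t : M → N → P}
    (ht : IsInteriorTensor A B lactN t) (x : P) :
    x = sSup {y | (∃ i : M × N, y = t i.1 i.2) ∧ y ≤ x} := by
  conv_lhs => rw [ht.gen x]
  simp only [Prod.exists]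

/-- The canonical unitary `A ⊗̇_A X ≅ X`. -/
theorem unit_iso {A : Type u} [InvQuantale A] (hA : InvQuantale.MReg A)
    (X : BimodObj A B) (he : LEssentialAct X.lact) (F : StarFunctor A B)
    (t : ∀ Y : HObj A, Y.carrier → X.carrier → (F.toFunctor.obj Y).carrier)
    (ht : ∀ Y : HObj A, IsInteriorTensor A B X.lact (t Y))
    (hm : ∀ (Y Y' : HObj A) (f : Y ⟶ Y') (x : Y.carrier) (z : X.carrier),
      (F.toFunctor.map f).1 (t Y x z) = t Y' (f.1 x) z) :
    ∃ U : (F.toFunctor.obj (selfObj A hA)).carrier → X.carrier, Function.Bijective U ∧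
      (∀ x y, qip B (U x) (U y) = qip B x y) ∧
      ∀ (a : A) (p), U ((F.toFunctor.map (lmulHom A hA a)).1 p) = X.lact a (U p) := by
  obtain ⟨U, hb, hi, hU⟩ := exists_unitary (B := B)
    (fun i : (selfObj A hA).carrier × X.carrier => t (selfObj A hA) i.1 i.2)
    (fun i : (selfObj A hA).carrier × X.carrier => X.lact i.1 i.2)
    (tensor_gen (ht _))
    (fun x => by
      conv_lhs => rw [he x]
      simp only [Prod.exists]
      rfl)
    (fun i j => by
      exact ((ht _).ip_t _ _ _ _).trans ((congrArg (qip B i.2)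
        (X.bimod.lact_mul (Star.star (show A from i.1)) j.1 j.2)).trans
        (X.bimod.ip_lact i.1 i.2 (X.lact j.1 j.2)).symm))
  refine ⟨U, hb, hi, fun a p => ?_⟩
  have hl : Adjointable B (X.lact a) := ⟨X.lact (Star.star a), X.bimod.ip_lact a⟩
  refine adj_ext (B := B) (adj_comp (F.toFunctor.map (lmulHom A hA a)).2 (adj_of_iso hb hi))
    (adj_comp (adj_of_iso hb hi) hl) _ (tensor_gen (ht (selfObj A hA))) ?_ p
  rintro ⟨c, z⟩
  beta_reduce
  rw [hm]
  have e1 := hU ((lmulHom A hA a).1 c, z)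
  have e2 := hU (c, z)
  dsimp only at e1 e2 ⊢
  rw [e1, e2]
  exact X.bimod.lact_mul a c z

end Helpers

/-- Let `X₁`, `X₂` be essential right Hilbert `A`–`B` bimodules such
that `F₁ = (−)⊗̇_A X₁` and `F₂ = (−)⊗̇_A X₂` define ⋆-functors (witnessed by the
realizations `t₁, t₂`).  Then `F₁ ≅ F₂` via a unitary natural isomorphism iff
`X₁ ≅ X₂` unitarily and as bimodules. -/
theorem tensor_functors_iso_iff_bimodules_iso (A B : Type u)
    [InvQuantale A] [InvQuantale B]
    (hA : InvQuantale.MReg A) (hB : InvQuantale.MReg B)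
    (X₁ X₂ : BimodObj A B)
    (he₁ : LEssentialAct X₁.lact) (he₂ : LEssentialAct X₂.lact)
    (F₁ F₂ : StarFunctor A B)
    (t₁ : ∀ Y : HObj A, Y.carrier → X₁.carrier → (F₁.toFunctor.obj Y).carrier)
    (t₂ : ∀ Y : HObj A, Y.carrier → X₂.carrier → (F₂.toFunctor.obj Y).carrier)
    (ht₁ : ∀ Y : HObj A, IsInteriorTensor A B X₁.lact (t₁ Y))
    (ht₂ : ∀ Y : HObj A, IsInteriorTensor A B X₂.lact (t₂ Y))
    (hm₁ : ∀ (Y Y' : HObj A) (f : Y ⟶ Y') (x : Y.carrier) (z : X₁.carrier),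
      (F₁.toFunctor.map f).1 (t₁ Y x z) = t₁ Y' (f.1 x) z)
    (hm₂ : ∀ (Y Y' : HObj A) (f : Y ⟶ Y') (x : Y.carrier) (z : X₂.carrier),
      (F₂.toFunctor.map f).1 (t₂ Y x z) = t₂ Y' (f.1 x) z) :
    (∃ τ : F₁.toFunctor ⟶ F₂.toFunctor, ∀ Y : HObj A, IsUnitaryHom (τ.app Y)) ↔
    (∃ Φ : X₁.carrier → X₂.carrier, Function.Bijective Φ ∧
      (∀ S : Set X₁.carrier, Φ (sSup S) = ⨆ x ∈ S, Φ x) ∧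
      (∀ (a : A) (x : X₁.carrier), Φ (X₁.lact a x) = X₂.lact a (Φ x)) ∧
      (∀ (x : X₁.carrier) (b : B), Φ (qact x b) = qact (Φ x) b) ∧
      (∀ x y : X₁.carrier, qip B (Φ x) (Φ y) = qip B x y)) := by
  constructor
  · rintro ⟨τ, hτ⟩
    obtain ⟨U₁, hb₁, hi₁, hl₁⟩ := unit_iso hA X₁ he₁ F₁ t₁ ht₁ hm₁
    obtain ⟨U₂, hb₂, hi₂, hl₂⟩ := unit_iso hA X₂ he₂ F₂ t₂ ht₂ hm₂
    obtain ⟨hb, hi⟩ := iso_of_unitary _ (hτ (selfObj A hA))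
    obtain ⟨V, hVU, hUV⟩ := Function.bijective_iff_has_inverse.1 hb₁
    have hVb : Function.Bijective V := Function.bijective_iff_has_inverse.2 ⟨U₁, hUV, hVU⟩
    have hVi : ∀ x y, qip B (V x) (V y) = qip B x y := fun x y => by
      rw [← hi₁, hUV, hUV]
    have hΦb : Function.Bijective (fun x => U₂ ((τ.app (selfObj A hA)).1 (V x))) :=
      hb₂.comp (hb.comp hVb)
    have hΦi : ∀ x y, qip B (U₂ ((τ.app (selfObj A hA)).1 (V x)))
        (U₂ ((τ.app (selfObj A hA)).1 (V y))) = qip B x y := fun x y => by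
      rw [hi₂, hi, hVi]
    have hadj := adj_of_iso hΦb hΦi
    refine ⟨_, hΦb, adj_sSup hadj, fun a x => ?_, adj_act hadj, hΦi⟩
    have e : V (X₁.lact a x) = (F₁.toFunctor.map (lmulHom A hA a)).1 (V x) := by
      apply hb₁.1
      rw [hUV, hl₁, hUV]
    have n := congrFun (congrArg Subtype.val (τ.naturality (lmulHom A hA a))) (V x)
    change (τ.app (selfObj A hA)).1 ((F₁.toFunctor.map (lmulHom A hA a)).1 (V x)) =
      (F₂.toFunctor.map (lmulHom A hA a)).1 ((τ.app (selfObj A hA)).1 (V x)) at n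
    beta_reduce
    rw [e, n, hl₂]
  · rintro ⟨Φ, hΦb, -, hΦl, -, hΦi⟩
    have key := fun Y : HObj A => exists_unitary (B := B)
      (fun i : Y.carrier × X₁.carrier => t₁ Y i.1 i.2)
      (fun i : Y.carrier × X₁.carrier => t₂ Y i.1 (Φ i.2))
      (tensor_gen (ht₁ Y))
      (fun x => by
        conv_lhs => rw [(ht₂ Y).gen x]
        simp only [Prod.exists, hΦb.2.exists])
      (fun i j => by
        rw [(ht₁ Y).ip_t, (ht₂ Y).ip_t, ← hΦl, hΦi])
    choose U hb hi hU using key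
    refine ⟨{ app := fun Y => ⟨U Y, adj_of_iso (hb Y) (hi Y)⟩, naturality := ?_ },
      fun Y => unitary_of_iso _ (hb Y) (hi Y)⟩
    intro Y Y' f
    refine Subtype.ext (funext fun p => ?_)
    change U Y' ((F₁.toFunctor.map f).1 p) = (F₂.toFunctor.map f).1 (U Y p)
    refine adj_ext (B := B) (adj_comp (F₁.toFunctor.map f).2 (adj_of_iso (hb Y') (hi Y')))
      (adj_comp (adj_of_iso (hb Y) (hi Y)) (F₂.toFunctor.map f).2) _ (tensor_gen (ht₁ Y)) ?_ p
    rintro ⟨c, z⟩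
    beta_reduce
    rw [hm₁]
    have e1 := hU Y' (f.1 c, z)
    have e2 := hU Y (c, z)
    dsimp only at e1 e2 ⊢
    rw [e1, e2, hm₂]
end
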